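/- arXiv:2102.06028 — 2 statements merged into one kernel-verified Lean document; each statement's English description precedes it below -/
import Mathlib

section
/- In the channel-free TCP system G_a with the less-powerful attacked network G_N,a^w (the nominal network plus the single attack transition q_SYN^B−SYN_ACK_NB→init), with controllable events Σ_c = {SYN_AN, SYN_ACK_NB} (so Σ_uc = Σ \ Σ_c) and observable events Σ_o = { m_AN, m_BN, m_NA, m_NB : m ∈ {SYN, ACK, FIN, SYN_ACK} } with natural projection P, the string SYN_BN · SYN_ACK_NB · ACK_BN belongs to L(G_a) and the state reached after it has Peer A at 'closed' and Peer B at 'established'. Moreover, letting M_TM1 = { s ∈ L(G_a) : the state reached after s has A = closed and B = established }, there exists a nonempty sublanguage K ⊆ M_TM1 that is controllable with respect to (L(G_a), Σ_uc) and normal with respect to (L(G_a), P); hence a For-all attack against Threat Model 1 exists even for this less-powerful attacker. -/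
/-! Channel-free model of TCP connection establishment (three-way handshake):
Peer A and Peer B (with timeout), composed synchronously with a network automaton. -/

/-- Packet types. -/
inductive Pkt | syn | ack | fin | synack deriving DecidableEq

/-- Events of the channel-free TCP system: `an m` = packet `m` sent from Peer A to the
network, `na m` = from the network to Peer A, `bn m` = from Peer B to the network,
`nb m` = from the network to Peer B, plus the private peer events. -/
inductive Ev
  | an : Pkt → Ev
  | na : Pkt → Ev
  | bn : Pkt → Ev
  | nb : Pkt → Ev
  | listenA | listenB | timeoutA | timeoutB | delA | delB
  deriving DecidableEq

/-- TCP peer states. -/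
inductive PSt
  | closed | synsent | listen | i0 | i1 | i2 | established | synreceived | i3
  | closewait | lastack | finwait1 | finwait2 | i4 | i5 | closing | timewait
  deriving DecidableEq

/-- TCP peer transitions (with timeout), parametrized by the peer's send events `snd`,
receive events `rcv`, and private events `lst`, `tmo`, `del`. -/
def peerTrans (snd rcv : Pkt → Ev) (lst tmo del : Ev) : List (PSt × Ev × PSt) :=
  [(.closed, snd .syn, .synsent), (.synsent, rcv .synack, .i0), (.i0, snd .ack, .established),
   (.synsent, rcv .syn, .i1), (.i1, snd .ack, .synreceived),
   (.synreceived, rcv .ack, .established),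
   (.closed, lst, .listen), (.listen, tmo, .closed), (.listen, rcv .syn, .i2),
   (.i2, snd .synack, .synreceived),
   (.established, rcv .fin, .i3), (.i3, snd .ack, .closewait),
   (.closewait, snd .fin, .lastack), (.lastack, rcv .ack, .closed),
   (.established, snd .fin, .finwait1), (.finwait1, rcv .ack, .finwait2),
   (.finwait1, rcv .fin, .i4), (.finwait2, rcv .fin, .i5),
   (.i4, snd .ack, .closing), (.closing, rcv .ack, .closed),
   (.i5, snd .ack, .timewait), (.timewait, del, .closed)]

/-- A peer's alphabet. -/
def peerAlph (snd rcv : Pkt → Ev) (lst tmo del : Ev) (e : Ev) : Prop :=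
  (∃ m, e = snd m) ∨ (∃ m, e = rcv m) ∨ e = lst ∨ e = tmo ∨ e = del

/-- Peer A: sends `an m`, receives `na m`. -/
def peerAStep (q : PSt) (e : Ev) (q' : PSt) : Prop :=
  (q, e, q') ∈ peerTrans Ev.an Ev.na .listenA .timeoutA .delA
def peerAAlph : Ev → Prop := peerAlph Ev.an Ev.na .listenA .timeoutA .delA

/-- Peer B: sends `bn m`, receives `nb m`. -/
def peerBStep (q : PSt) (e : Ev) (q' : PSt) : Prop :=
  (q, e, q') ∈ peerTrans Ev.bn Ev.nb .listenB .timeoutB .delB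
def peerBAlph : Ev → Prop := peerAlph Ev.bn Ev.nb .listenB .timeoutB .delB

/-- Network states: `init`, plus a state `qa m` / `qb m` per packet in transit. -/
inductive NSt | init | qa : Pkt → NSt | qb : Pkt → NSt
  deriving DecidableEq

/-- The network alphabet: all packet events. -/
def netAlph (e : Ev) : Prop :=
  (∃ m, e = Ev.an m) ∨ (∃ m, e = Ev.na m) ∨ (∃ m, e = Ev.bn m) ∨ (∃ m, e = Ev.nb m)

/-- Nominal network transitions. -/
def netTransNom (q : NSt) (e : Ev) (q' : NSt) : Prop :=
  (∃ m, q = .init ∧ e = .an m ∧ q' = .qa m) ∨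
  (∃ m, q = .qa m ∧ e = .nb m ∧ q' = .init) ∨
  (∃ m, q = .init ∧ e = .bn m ∧ q' = .qb m) ∨
  (∃ m, q = .qb m ∧ e = .na m ∧ q' = .init)

/-- The attacker's controllable events: the outgoing packets of the network. -/
def ATTK : Set Ev := {e | ∃ m, e = Ev.na m ∨ e = Ev.nb m}

/-- Attacked network transitions: from any non-initial state the attacker may emit any
event of `ATTK`. -/
def netTransAtk (q : NSt) (e : Ev) (q' : NSt) : Prop :=
  (∃ m, q = .init ∧ e = .an m ∧ q' = .qa m) ∨
  (∃ m, q = .init ∧ e = .bn m ∧ q' = .qb m) ∨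
  ((∃ m, q = .qa m ∨ q = .qb m) ∧ e ∈ ATTK ∧ q' = .init)

/-- Synchronization of one component: if the event is in the component's alphabet, the
component must execute a transition on it; otherwise the component does not move. -/
def sync {Q : Type*} (alph : Ev → Prop) (trans : Q → Ev → Q → Prop)
    (q : Q) (e : Ev) (q' : Q) : Prop :=
  (alph e ∧ trans q e q') ∨ (¬ alph e ∧ q' = q)

/-- Global states of the channel-free TCP system. -/
structure GSt where
  pa : PSt
  pb : PSt
  net : NSt
  deriving DecidableEq

/-- Global step of the synchronous composition, parametrized by the network. -/
def gstep (net : NSt → Ev → NSt → Prop) (q : GSt) (e : Ev) (q' : GSt) : Prop :=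
  sync peerAAlph peerAStep q.pa e q'.pa ∧
  sync peerBAlph peerBStep q.pb e q'.pb ∧
  sync netAlph net q.net e q'.net

/-- Runs of the composition. -/
inductive Reach (step : GSt → Ev → GSt → Prop) (q0 : GSt) : List Ev → GSt → Prop
  | nil : Reach step q0 [] q0
  | snoc {s : List Ev} {q : GSt} {e : Ev} {q' : GSt} :
      Reach step q0 s q → step q e q' → Reach step q0 (s ++ [e]) q'

/-- Initial global state. -/
def init : GSt := ⟨.closed, .closed, .init⟩

/-- Generated language. -/
def Lang (step : GSt → Ev → GSt → Prop) : Set (List Ev) :=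
  {s | ∃ q, Reach step init s q}

/-! Abstract supervisory-control notions on languages. -/

/-- Prefix closure `pr(K)`. -/
def prefixClosure {A : Type*} (K : Set (List A)) : Set (List A) := {s | ∃ t ∈ K, s <+: t}

/-- Controllability of `K` w.r.t. `(L, Auc)`. -/
def IsControllable {A : Type*} (K L : Set (List A)) (Auc : Set A) : Prop :=
  ∀ s ∈ prefixClosure K, ∀ σ ∈ Auc, s ++ [σ] ∈ L → s ++ [σ] ∈ prefixClosure K

/-- Normality of `K` w.r.t. `(L, P)`: `pr(K) = P⁻¹(P(pr(K))) ∩ L`. -/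
def IsNormalLang {A : Type*} (K L : Set (List A)) (P : List A → List A) : Prop :=
  prefixClosure K = {s | ∃ t ∈ prefixClosure K, P s = P t} ∩ L

/-- The less-powerful attacked network `G_N,a^w`: the nominal network plus the single
attack transition `q_SYN^B −SYN_ACK_NB→ init`. -/
def netTransWeak (q : NSt) (e : Ev) (q' : NSt) : Prop :=
  netTransNom q e q' ∨ (q = .qb .syn ∧ e = .nb .synack ∧ q' = .init)

/-- The channel-free TCP system with the less-powerful attacked network. -/
def weakStep : GSt → Ev → GSt → Prop := gstep netTransWeak

/-- The attacker's controllable events in this setup: `Ec = {SYN_AN, SYN_ACK_NB}`. -/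
def Ec : Set Ev := {Ev.an Pkt.syn, Ev.nb Pkt.synack}

/-- Natural projection onto the attacker's observable events (all packet events). -/
def P (s : List Ev) : List Ev :=
  s.filter (fun e => match e with
    | .an _ => true | .na _ => true | .bn _ => true | .nb _ => true
    | _ => false)

/-- Violation of Threat Model 1: strings after which Peer A is at `closed` while Peer B
is at `established`. -/
def MTM1 : Set (List Ev) :=
  {s | ∃ q : GSt, Reach weakStep init s q ∧ q.pa = PSt.closed ∧ q.pb = PSt.established}

/-- Transitions of Peer A. -/
abbrev transA : List (PSt × Ev × PSt) := peerTrans Ev.an Ev.na .listenA .timeoutA .delA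

/-- Transitions of Peer B. -/
abbrev transB : List (PSt × Ev × PSt) := peerTrans Ev.bn Ev.nb .listenB .timeoutB .delB

/-- The (deterministic) next-state function of the weakly attacked network, which ignores the
private events of the peers. -/
def netNext : NSt → Ev → Option NSt
  | .init, .an m => some (.qa m)
  | .init, .bn m => some (.qb m)
  | .qa m, .nb m' => if m = m' then some .init else none
  | .qb m, .na m' => if m = m' then some .init else none
  | .qb .syn, .nb .synack => some .init
  | n, .listenA => some n
  | n, .listenB => some n
  | n, .timeoutA => some n
  | n, .timeoutB => some n
  | n, .delA => some n
  | n, .delB => some n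
  | _, _ => none

lemma sync_net_iff (n n' : NSt) (e : Ev) :
    sync netAlph netTransWeak n e n' ↔ netNext n e = some n' := by
  rcases n with _ | (_ | _ | _ | _) | (_ | _ | _ | _) <;>
    rcases e with (_ | _ | _ | _) | (_ | _ | _ | _) | (_ | _ | _ | _) | (_ | _ | _ | _) |
      _ | _ | _ | _ | _ | _ <;>
    simp [sync, netAlph, netTransWeak, netTransNom, netNext, eq_comm]

lemma alph_or (e : Ev) :
    (peerAAlph e ∧ ¬ peerBAlph e) ∨ (¬ peerAAlph e ∧ peerBAlph e) := by
  cases e <;> simp [peerAAlph, peerBAlph, peerAlph]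

lemma alphA_of_mem {t : PSt × Ev × PSt} (h : t ∈ transA) : peerAAlph t.2.1 := by
  simp only [peerTrans, List.mem_cons, List.not_mem_nil, or_false] at h
  rcases h with rfl | rfl | rfl | rfl | rfl | rfl | rfl | rfl | rfl | rfl | rfl | rfl | rfl |
    rfl | rfl | rfl | rfl | rfl | rfl | rfl | rfl | rfl <;> simp [peerAAlph, peerAlph]

lemma alphB_of_mem {t : PSt × Ev × PSt} (h : t ∈ transB) : peerBAlph t.2.1 := by
  simp only [peerTrans, List.mem_cons, List.not_mem_nil, or_false] at h
  rcases h with rfl | rfl | rfl | rfl | rfl | rfl | rfl | rfl | rfl | rfl | rfl | rfl | rfl |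
    rfl | rfl | rfl | rfl | rfl | rfl | rfl | rfl | rfl <;> simp [peerBAlph, peerAlph]

/-- In each global step exactly one peer moves. -/
lemma weakStep_iff (q : GSt) (e : Ev) (q' : GSt) :
    weakStep q e q' ↔
      ((q.pa, e, q'.pa) ∈ transA ∧ q'.pb = q.pb ∧ netNext q.net e = some q'.net) ∨
      ((q.pb, e, q'.pb) ∈ transB ∧ q'.pa = q.pa ∧ netNext q.net e = some q'.net) := by
  have hA : (q.pa, e, q'.pa) ∈ transA → peerAAlph e := fun h => alphA_of_mem h
  have hB : (q.pb, e, q'.pb) ∈ transB → peerBAlph e := fun h => alphB_of_mem h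
  rw [weakStep, gstep, sync_net_iff]
  have := alph_or e
  simp only [sync, peerAStep, peerBStep]
  tauto

/-- The global states reachable without Peer A sending a `SYN`, by increasing distance to a state
with Peer A closed and Peer B established. -/
def safeStates : List GSt :=
  [⟨.closed, .established, .qb .ack⟩, ⟨.closed, .i0, .init⟩, ⟨.listen, .established, .qb .ack⟩,
   ⟨.timewait, .established, .qb .ack⟩, ⟨.closed, .synsent, .qb .syn⟩, ⟨.listen, .i0, .init⟩,
   ⟨.timewait, .i0, .init⟩, ⟨.closed, .closed, .init⟩, ⟨.listen, .synsent, .qb .syn⟩,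
   ⟨.timewait, .synsent, .qb .syn⟩, ⟨.listen, .closed, .init⟩, ⟨.closed, .listen, .init⟩,
   ⟨.closed, .lastack, .qa .ack⟩, ⟨.timewait, .closed, .init⟩, ⟨.closed, .timewait, .init⟩,
   ⟨.lastack, .closed, .qb .ack⟩, ⟨.listen, .listen, .init⟩, ⟨.timewait, .lastack, .qa .ack⟩,
   ⟨.lastack, .timewait, .qb .ack⟩, ⟨.listen, .lastack, .qa .ack⟩, ⟨.timewait, .listen, .init⟩,
   ⟨.listen, .timewait, .init⟩, ⟨.lastack, .listen, .qb .ack⟩, ⟨.i5, .lastack, .init⟩,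
   ⟨.lastack, .i5, .init⟩, ⟨.finwait2, .lastack, .qb .fin⟩, ⟨.lastack, .finwait2, .qa .fin⟩,
   ⟨.finwait2, .closewait, .init⟩, ⟨.closewait, .finwait2, .init⟩, ⟨.finwait1, .closewait, .qb .ack⟩,
   ⟨.closewait, .finwait1, .qa .ack⟩, ⟨.finwait1, .i3, .init⟩, ⟨.i3, .finwait1, .init⟩,
   ⟨.finwait1, .established, .qa .fin⟩, ⟨.established, .finwait1, .qb .fin⟩, ⟨.established, .established, .init⟩,
   ⟨.synreceived, .established, .qb .ack⟩, ⟨.synreceived, .i0, .init⟩, ⟨.synreceived, .synsent, .qa .synack⟩,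
   ⟨.i2, .synsent, .init⟩]

lemma safeStates_closed {q : GSt} (hq : q ∈ safeStates) {e : Ev} (he : e ≠ .an .syn) {q' : GSt}
    (h : weakStep q e q') : q' ∈ safeStates := by
  have hA : ∀ q ∈ safeStates, ∀ t ∈ transA, t.1 = q.pa → t.2.1 ≠ .an .syn →
      ∀ n ∈ netNext q.net t.2.1, (⟨t.2.2, q.pb, n⟩ : GSt) ∈ safeStates := by decide +kernel
  have hB : ∀ q ∈ safeStates, ∀ t ∈ transB, t.1 = q.pb → t.2.1 ≠ .an .syn →
      ∀ n ∈ netNext q.net t.2.1, (⟨q.pa, t.2.2, n⟩ : GSt) ∈ safeStates := by decide +kernel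
  obtain ⟨a, b, n⟩ := q'
  rcases (weakStep_iff _ _ _).1 h with ⟨ht, rfl, hn⟩ | ⟨ht, rfl, hn⟩
  · exact hA q hq _ ht rfl he _ hn
  · exact hB q hq _ ht rfl he _ hn

lemma safeStates_progress {q : GSt} (hq : q ∈ safeStates) :
    (q.pa = .closed ∧ q.pb = .established) ∨
      ∃ e q', e ≠ .an .syn ∧ weakStep q e q' ∧ q' ∈ safeStates ∧
        safeStates.idxOf q' < safeStates.idxOf q := by
  have key : ∀ q ∈ safeStates, (q.pa = .closed ∧ q.pb = .established) ∨
      (∃ t ∈ transA, t.1 = q.pa ∧ t.2.1 ≠ .an .syn ∧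
        ∃ n ∈ netNext q.net t.2.1, (⟨t.2.2, q.pb, n⟩ : GSt) ∈ safeStates ∧
          safeStates.idxOf (⟨t.2.2, q.pb, n⟩ : GSt) < safeStates.idxOf q) ∨
      (∃ t ∈ transB, t.1 = q.pb ∧ t.2.1 ≠ .an .syn ∧
        ∃ n ∈ netNext q.net t.2.1, (⟨q.pa, t.2.2, n⟩ : GSt) ∈ safeStates ∧
          safeStates.idxOf (⟨q.pa, t.2.2, n⟩ : GSt) < safeStates.idxOf q) := by
    decide +kernel
  rcases key q hq with h | ⟨⟨_, e, c⟩, ht, rfl, he, n, hn, hm, hlt⟩ |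
    ⟨⟨_, e, c⟩, ht, rfl, he, n, hn, hm, hlt⟩
  · exact .inl h
  · exact .inr ⟨e, ⟨c, q.pb, n⟩, he, (weakStep_iff _ _ _).2 (.inl ⟨ht, rfl, hn⟩), hm, hlt⟩
  · exact .inr ⟨e, ⟨q.pa, c, n⟩, he, (weakStep_iff _ _ _).2 (.inr ⟨ht, rfl, hn⟩), hm, hlt⟩

lemma reach_nil_iff {step : GSt → Ev → GSt → Prop} {q₀ q : GSt} :
    Reach step q₀ [] q ↔ q = q₀ := by
  refine ⟨fun h => ?_, fun h => h ▸ .nil⟩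
  generalize hs : ([] : List Ev) = s at h
  cases h with
  | nil => rfl
  | snoc => simp at hs

lemma reach_snoc_iff {step : GSt → Ev → GSt → Prop} {q₀ q' : GSt} {s : List Ev} {e : Ev} :
    Reach step q₀ (s ++ [e]) q' ↔ ∃ q, Reach step q₀ s q ∧ step q e q' := by
  refine ⟨fun h => ?_, fun ⟨q, h, h'⟩ => .snoc h h'⟩
  generalize hs : s ++ [e] = u at h
  cases h with
  | nil => simp at hs
  | snoc h h' =>
    obtain ⟨rfl, rfl⟩ := List.append_singleton_inj.1 hs
    exact ⟨_, h, h'⟩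

lemma Reach.mem_safeStates {s : List Ev} {q : GSt} (h : Reach weakStep init s q)
    (hs : .an .syn ∉ s) : q ∈ safeStates := by
  induction h with
  | nil => decide
  | snoc _ h' ih =>
    simp only [List.mem_append, List.mem_singleton, not_or] at hs
    exact safeStates_closed (ih hs.1) (Ne.symm hs.2) h'

lemma lang_of_prefix {step : GSt → Ev → GSt → Prop} {s t : List Ev} (h : s <+: t)
    (ht : t ∈ Lang step) : s ∈ Lang step := by
  obtain ⟨u, rfl⟩ := h
  induction u using List.reverseRecOn with
  | nil => simpa using ht
  | append_singleton u e ih =>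
    obtain ⟨q, hq⟩ := ht
    rw [← List.append_assoc, reach_snoc_iff] at hq
    obtain ⟨q', hq', -⟩ := hq
    exact ih ⟨q', hq'⟩

/-- The strings violating Threat Model 1 in which Peer A never sends a `SYN`. -/
def attackLang : Set (List Ev) := {s | s ∈ MTM1 ∧ .an .syn ∉ s}

lemma mem_prefixClosure_of_reach {s : List Ev} {q : GSt} (h : Reach weakStep init s q)
    (hs : .an .syn ∉ s) : s ∈ prefixClosure attackLang := by
  induction hk : safeStates.idxOf q using Nat.strong_induction_on generalizing s q with
  | _ k ih =>
    rcases safeStates_progress (h.mem_safeStates hs) with hq | ⟨e, q', he, hstep, -, hlt⟩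
    · exact ⟨s, ⟨⟨q, h, hq⟩, hs⟩, List.prefix_rfl⟩
    · obtain ⟨t, ht, hst⟩ := ih _ (hk ▸ hlt) (h.snoc hstep) (by simp [hs, he.symm]) rfl
      exact ⟨t, ht, (List.prefix_append _ _).trans hst⟩

lemma mem_prefixClosure_attackLang_iff {s : List Ev} :
    s ∈ prefixClosure attackLang ↔ s ∈ Lang weakStep ∧ .an .syn ∉ s := by
  refine ⟨fun ⟨t, ⟨⟨q, hq, _⟩, ht⟩, hst⟩ => ?_, fun ⟨⟨q, hq⟩, hs⟩ => ?_⟩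
  · exact ⟨lang_of_prefix hst ⟨q, hq⟩, fun h => ht (hst.subset h)⟩
  · exact mem_prefixClosure_of_reach hq hs

lemma reach_attack_iff {q : GSt} :
    Reach weakStep init [.bn .syn, .nb .synack, .bn .ack] q ↔
      q = ⟨.closed, .established, .qb .ack⟩ := by
  have hs : ([.bn .syn, .nb .synack, .bn .ack] : List Ev) =
    (([] ++ [.bn .syn]) ++ [.nb .synack]) ++ [.bn .ack] := rfl
  have h₁ (q : GSt) : weakStep init (.bn .syn) q ↔ q = ⟨.closed, .synsent, .qb .syn⟩ := by
    cases q; simp [weakStep_iff, init, peerTrans, netNext]; tauto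
  have h₂ (q : GSt) : weakStep ⟨.closed, .synsent, .qb .syn⟩ (.nb .synack) q ↔
      q = ⟨.closed, .i0, .init⟩ := by
    cases q; simp [weakStep_iff, peerTrans, netNext]; tauto
  have h₃ (q : GSt) : weakStep ⟨.closed, .i0, .init⟩ (.bn .ack) q ↔
      q = ⟨.closed, .established, .qb .ack⟩ := by
    cases q; simp [weakStep_iff, peerTrans, netNext]; tauto
  simp only [hs, reach_snoc_iff, reach_nil_iff, exists_eq_left, h₁, h₂, h₃]

/-- the string `SYN_BN · SYN_ACK_NB · ACK_BN` belongs to `L(G_a)` and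
leads to a state with Peer A at `closed` and Peer B at `established`; moreover there is
a nonempty sublanguage `K ⊆ M_TM1` controllable w.r.t. `(L(G_a), Σ \ Ec)` and normal
w.r.t. `(L(G_a), P)`: a For-all attack against Threat Model 1 exists even for this
less-powerful attacker. -/
theorem stmt16 :
    ([.bn .syn, .nb .synack, .bn .ack] : List Ev) ∈ Lang weakStep ∧
    (∀ q : GSt, Reach weakStep init [.bn .syn, .nb .synack, .bn .ack] q →
      q.pa = PSt.closed ∧ q.pb = PSt.established) ∧
    ∃ K : Set (List Ev), K.Nonempty ∧ K ⊆ MTM1 ∧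
      IsControllable K (Lang weakStep) Ecᶜ ∧
      IsNormalLang K (Lang weakStep) P := by
  have hreach := reach_attack_iff.2 rfl
  refine ⟨⟨_, hreach⟩, fun q hq => ?_, attackLang, ⟨_, ⟨_, hreach, rfl, rfl⟩, by decide⟩,
    fun s hs => hs.1, fun s hs σ hσ hL => ?_, ?_⟩
  · rw [reach_attack_iff.1 hq]
    exact ⟨rfl, rfl⟩
  · rw [mem_prefixClosure_attackLang_iff] at hs ⊢
    have : Ev.an .syn ≠ σ := fun h => hσ (h ▸ .inl rfl)
    exact ⟨hL, by simp [hs.2, this]⟩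
  · have hP (s : List Ev) : Ev.an .syn ∈ P s ↔ .an .syn ∈ s := by simp [P]
    refine Set.Subset.antisymm
      (fun s hs => ⟨⟨s, hs, rfl⟩, (mem_prefixClosure_attackLang_iff.1 hs).1⟩) ?_
    rintro s ⟨⟨t, ht, hst⟩, hL⟩
    rw [mem_prefixClosure_attackLang_iff] at ht ⊢
    exact ⟨hL, by rw [← hP, hst, hP]; exact ht.2⟩
end

section
/- In the channel-free TCP system G_a with the less-powerful attacked network G_N,a^w, if the event SYN_AN is made uncontrollable, i.e., the controllable event set is reduced to Σ_c = {SYN_ACK_NB} (so Σ_uc = Σ \ {SYN_ACK_NB}), with observable events Σ_o = { m_AN, m_BN, m_NA, m_NB : m ∈ {SYN, ACK, FIN, SYN_ACK} } and natural projection P, then every sublanguage K ⊆ M_TM1 = { s ∈ L(G_a) : the state reached after s has Peer A at 'closed' and Peer B at 'established' } that is controllable with respect to (L(G_a), Σ_uc) and normal with respect to (L(G_a), P) is empty; i.e., the attacker must be able to disable SYN_AN for a For-all attack against Threat Model 1 to exist. -/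
/-- All events. -/
def allEvents : List Ev :=
  [Pkt.syn, .ack, .fin, .synack].flatMap (fun m => [Ev.an m, .na m, .bn m, .nb m]) ++
    [.listenA, .listenB, .timeoutA, .timeoutB, .delA, .delB]

lemma mem_allEvents (e : Ev) : e ∈ allEvents := by
  rcases e with m | m | m | m | _ | _ | _ | _ | _ | _ <;> first | decide | (cases m <;> decide)

/-- Boolean test for the alphabet of Peer A. -/
def inAlphA : Ev → Bool
  | .an _ | .na _ | .listenA | .timeoutA | .delA => true
  | _ => false

/-- Boolean test for the alphabet of Peer B. -/
def inAlphB : Ev → Bool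
  | .bn _ | .nb _ | .listenB | .timeoutB | .delB => true
  | _ => false

lemma peerAAlph_iff (e : Ev) : peerAAlph e ↔ inAlphA e = true := by
  cases e <;> simp [peerAAlph, peerAlph, inAlphA]

lemma peerBAlph_iff (e : Ev) : peerBAlph e ↔ inAlphB e = true := by
  cases e <;> simp [peerBAlph, peerAlph, inAlphB]

/-- Successors of a peer state, from its alphabet test and transition list. -/
def peerSuccs (alph : Ev → Bool) (l : List (PSt × Ev × PSt)) (q : PSt) (e : Ev) : List PSt :=
  if alph e then l.filterMap (fun t => if t.1 = q ∧ t.2.1 = e then some t.2.2 else none) else [q]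

/-- Successors of a state of the attacked network. -/
def netSuccs : NSt → Ev → List NSt
  | .init, .an m => [.qa m]
  | .init, .bn m => [.qb m]
  | .qa m, .nb m' => if m = m' then [.init] else []
  | .qb m, .na m' => if m = m' then [.init] else []
  | .qb .syn, .nb .synack => [.init]
  | q, .listenA | q, .listenB | q, .timeoutA | q, .timeoutB | q, .delA | q, .delB => [q]
  | _, _ => []

/-- Successors of a global state under an event. -/
def succs (q : GSt) (e : Ev) : List GSt :=
  (peerSuccs inAlphA (peerTrans Ev.an Ev.na .listenA .timeoutA .delA) q.pa e).flatMap fun a =>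
    (peerSuccs inAlphB (peerTrans Ev.bn Ev.nb .listenB .timeoutB .delB) q.pb e).flatMap fun b =>
      (netSuccs q.net e).map fun n => ⟨a, b, n⟩

lemma mem_peerSuccs {A : Ev → Prop} {alph : Ev → Bool} {l : List (PSt × Ev × PSt)}
    (hA : ∀ e, A e ↔ alph e = true) (q : PSt) (e : Ev) (q' : PSt) :
    q' ∈ peerSuccs alph l q e ↔ sync A (fun q e q' => (q, e, q') ∈ l) q e q' := by
  by_cases h : alph e = true <;> simp [peerSuccs, sync, hA, h]

lemma mem_netSuccs (q : NSt) (e : Ev) (q' : NSt) :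
    q' ∈ netSuccs q e ↔ sync netAlph netTransWeak q e q' := by
  rcases q with _ | m | m <;> rcases e with k | k | k | k | _ | _ | _ | _ | _ | _ <;>
    try cases m
  all_goals try cases k
  all_goals simp [netSuccs, sync, netAlph, netTransWeak, netTransNom]

lemma mem_succs {q q' : GSt} {e : Ev} : q' ∈ succs q e ↔ weakStep q e q' := by
  obtain ⟨a', b', n'⟩ := q'
  simp only [succs, List.mem_flatMap, List.mem_map, GSt.mk.injEq, weakStep, gstep,
    mem_peerSuccs peerAAlph_iff, mem_peerSuccs peerBAlph_iff, mem_netSuccs]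
  constructor
  · rintro ⟨_, ha, _, hb, _, hn, rfl, rfl, rfl⟩
    exact ⟨ha, hb, hn⟩
  · rintro ⟨ha, hb, hn⟩
    exact ⟨_, ha, _, hb, _, hn, rfl, rfl, rfl⟩

lemma sync_unique {Q : Type*} {alph : Ev → Prop} {trans : Q → Ev → Q → Prop}
    (h : ∀ {q e x y}, trans q e x → trans q e y → x = y) {q : Q} {e : Ev} {x y : Q}
    (hx : sync alph trans q e x) (hy : sync alph trans q e y) : x = y := by
  rcases hx with ⟨ax, hx⟩ | ⟨ax, rfl⟩ <;> rcases hy with ⟨ay, hy⟩ | ⟨ay, rfl⟩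
  · exact h hx hy
  · exact absurd ax ay
  · exact absurd ay ax
  · rfl

lemma peerAStep_unique {q x y : PSt} {e : Ev} (hx : peerAStep q e x) (hy : peerAStep q e y) :
    x = y := by
  have key : ∀ s ∈ peerTrans Ev.an Ev.na .listenA .timeoutA .delA,
      ∀ t ∈ peerTrans Ev.an Ev.na .listenA .timeoutA .delA,
      s.1 = t.1 → s.2.1 = t.2.1 → s.2.2 = t.2.2 := by decide +kernel
  exact key _ hx _ hy rfl rfl

lemma peerBStep_unique {q x y : PSt} {e : Ev} (hx : peerBStep q e x) (hy : peerBStep q e y) :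
    x = y := by
  have key : ∀ s ∈ peerTrans Ev.bn Ev.nb .listenB .timeoutB .delB,
      ∀ t ∈ peerTrans Ev.bn Ev.nb .listenB .timeoutB .delB,
      s.1 = t.1 → s.2.1 = t.2.1 → s.2.2 = t.2.2 := by decide +kernel
  exact key _ hx _ hy rfl rfl

lemma netTransWeak_unique {q x y : NSt} {e : Ev} (hx : netTransWeak q e x)
    (hy : netTransWeak q e y) : x = y := by
  unfold netTransWeak netTransNom at hx hy
  grind

lemma weakStep_unique {q x y : GSt} {e : Ev} (hx : weakStep q e x) (hy : weakStep q e y) :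
    x = y := by
  obtain ⟨a, b, n⟩ := x
  obtain ⟨a', b', n'⟩ := y
  obtain ⟨hxa, hxb, hxn⟩ := hx
  obtain ⟨hya, hyb, hyn⟩ := hy
  exact GSt.mk.injEq .. ▸ ⟨sync_unique peerAStep_unique hxa hya,
    sync_unique peerBStep_unique hxb hyb, sync_unique netTransWeak_unique hxn hyn⟩

lemma reach_unique {s t : List Ev} {x y : GSt} (hx : Reach weakStep init s x)
    (hy : Reach weakStep init t y) (hst : s = t) : x = y := by
  induction hx generalizing t y with
  | nil =>
    cases hy with
    | nil => rfl
    | snoc _ _ => simp at hst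
  | snoc _ hstep ih =>
    cases hy with
    | nil => simp at hst
    | snoc hy hstep' =>
      obtain ⟨hst', he⟩ := List.append_inj' hst rfl
      obtain rfl := List.singleton_inj.1 he
      obtain rfl := ih hy hst'
      exact weakStep_unique hstep hstep'

/-- A run extending a run into a deadlock state is that run itself. -/
lemma reach_eq_of_deadlock {w t : List Ev} {d q : GSt} (hw : Reach weakStep init w d)
    (hd : ∀ e q', ¬ weakStep d e q') (ht : Reach weakStep init t q) (hwt : w <+: t) :
    q = d := by
  have key : w = t := by
    induction ht with
    | nil => exact List.prefix_nil.1 hwt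
    | snoc ht hstep ih =>
      rcases List.prefix_concat_iff.1 hwt with h | h
      · exact h
      · obtain rfl := reach_unique hw ht (ih h)
        exact absurd hstep (hd _ _)
  exact (reach_unique hw ht key).symm

/-- The states reachable without using the attack transition. -/
def nominalStates : List GSt :=
  [⟨.closed, .closed, .init⟩, ⟨.closed, .lastack, .qa .ack⟩,
   ⟨.closed, .listen, .init⟩, ⟨.closed, .synsent, .qb .syn⟩,
   ⟨.closed, .timewait, .init⟩, ⟨.closewait, .finwait1, .qa .ack⟩,
   ⟨.closewait, .finwait2, .init⟩, ⟨.established, .established, .init⟩,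
   ⟨.established, .finwait1, .qb .fin⟩, ⟨.established, .synreceived, .qa .ack⟩,
   ⟨.finwait1, .closewait, .qb .ack⟩, ⟨.finwait1, .established, .qa .fin⟩,
   ⟨.finwait1, .i3, .init⟩, ⟨.finwait2, .closewait, .init⟩,
   ⟨.finwait2, .lastack, .qb .fin⟩, ⟨.i0, .synreceived, .init⟩,
   ⟨.i2, .synsent, .init⟩, ⟨.i3, .finwait1, .init⟩,
   ⟨.i5, .lastack, .init⟩, ⟨.lastack, .closed, .qb .ack⟩,
   ⟨.lastack, .finwait2, .qa .fin⟩, ⟨.lastack, .i5, .init⟩,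
   ⟨.lastack, .listen, .qb .ack⟩, ⟨.lastack, .timewait, .qb .ack⟩,
   ⟨.listen, .closed, .init⟩, ⟨.listen, .lastack, .qa .ack⟩,
   ⟨.listen, .listen, .init⟩, ⟨.listen, .synsent, .qb .syn⟩,
   ⟨.listen, .timewait, .init⟩, ⟨.synreceived, .established, .qb .ack⟩,
   ⟨.synreceived, .i0, .init⟩, ⟨.synreceived, .synsent, .qa .synack⟩,
   ⟨.synsent, .closed, .qa .syn⟩, ⟨.synsent, .i2, .init⟩,
   ⟨.synsent, .listen, .qa .syn⟩, ⟨.synsent, .synreceived, .qb .synack⟩,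
   ⟨.synsent, .timewait, .qa .syn⟩, ⟨.timewait, .closed, .init⟩,
   ⟨.timewait, .lastack, .qa .ack⟩, ⟨.timewait, .listen, .init⟩,
   ⟨.timewait, .synsent, .qb .syn⟩]

/-- The states in which the attack transition can be taken before it was ever used. -/
def attackStates : List GSt :=
  [⟨.closed, .synsent, .qb .syn⟩, ⟨.listen, .synsent, .qb .syn⟩, ⟨.timewait, .synsent, .qb .syn⟩]

lemma nominalStates_closed : ∀ q ∈ nominalStates, ∀ e ∈ allEvents, ∀ q' ∈ succs q e,
    q' ∈ nominalStates ∨ (e = .nb .synack ∧ q ∈ attackStates) := by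
  decide +kernel

lemma reach_nominal_or_attack {t : List Ev} {q : GSt} (h : Reach weakStep init t q) :
    q ∈ nominalStates ∨
      ∃ s r, s ++ [Ev.nb .synack] <+: t ∧ Reach weakStep init s r ∧ r ∈ attackStates := by
  induction h with
  | nil => exact .inl (by decide)
  | snoc hr hstep ih =>
    rcases ih with hq | ⟨s, r, hs, hrest⟩
    · rcases nominalStates_closed _ hq _ (mem_allEvents _) _ (mem_succs.2 hstep) with
        h | ⟨rfl, h⟩
      · exact .inl h
      · exact .inr ⟨_, _, List.prefix_rfl, hr, h⟩
    · exact .inr ⟨s, r, hs.trans (List.prefix_append _ _), hrest⟩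

/-- After the attack, uncontrollable events lead to Peer A closed and Peer B in `i0`. -/
lemma exists_closed_after_attack {K : Set (List Ev)}
    (hc : IsControllable K (Lang weakStep) ({Ev.nb Pkt.synack}ᶜ : Set Ev))
    {s : List Ev} {r : GSt} (hs : s ++ [Ev.nb .synack] ∈ prefixClosure K)
    (hr : Reach weakStep init s r) (hra : r ∈ attackStates) :
    ∃ u ∈ prefixClosure K, Reach weakStep init u ⟨.closed, .i0, .init⟩ := by
  have extend : ∀ (e : Ev) (a : PSt), e ≠ .nb .synack → weakStep ⟨a, .i0, .init⟩ e
      ⟨.closed, .i0, .init⟩ → Reach weakStep init (s ++ [.nb .synack]) ⟨a, .i0, .init⟩ →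
      ∃ u ∈ prefixClosure K, Reach weakStep init u ⟨.closed, .i0, .init⟩ :=
    fun e _ he hstep hreach =>
      ⟨_, hc _ hs e he ⟨_, hreach.snoc hstep⟩, hreach.snoc hstep⟩
  simp only [attackStates, List.mem_cons, List.not_mem_nil, or_false] at hra
  rcases hra with rfl | rfl | rfl
  · exact ⟨_, hs, hr.snoc (mem_succs.1 (by decide))⟩
  · exact extend .timeoutA .listen (by decide) (mem_succs.1 (by decide))
      (hr.snoc (mem_succs.1 (by decide)))
  · exact extend .delA .timewait (by decide) (mem_succs.1 (by decide))
      (hr.snoc (mem_succs.1 (by decide)))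

lemma deadlock_synsent_i0 (e : Ev) (q' : GSt) :
    ¬ weakStep ⟨.synsent, .i0, .qa .syn⟩ e q' := by
  have key : ∀ e ∈ allEvents, succs ⟨.synsent, .i0, .qa .syn⟩ e = [] := by decide +kernel
  intro h
  simpa [key e (mem_allEvents e)] using mem_succs.2 h

/-- if the controllable event set is reduced to `Ec = {SYN_ACK_NB}`
(so `SYN_AN` is uncontrollable), then every sublanguage of `M_TM1` that is controllable
w.r.t. `(L(G_a), Σ \ Ec)` and normal w.r.t. `(L(G_a), P)` is empty: the attacker must be
able to disable `SYN_AN` for a For-all attack against Threat Model 1 to exist. -/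
theorem stmt17 :
    ∀ K ⊆ MTM1,
      IsControllable K (Lang weakStep) ({Ev.nb Pkt.synack}ᶜ : Set Ev) →
      IsNormalLang K (Lang weakStep) P →
      K = ∅ := by
  intro K hK hc _
  refine Set.eq_empty_of_forall_notMem fun t ht => ?_
  obtain ⟨q, hq, hqa, hqb⟩ := hK ht
  rcases reach_nominal_or_attack hq with hn | ⟨s, r, hst, hr, hra⟩
  · have key : ∀ q ∈ nominalStates, q.pa = .closed → q.pb ≠ .established := by decide +kernel
    exact key q hn hqa hqb
  · obtain ⟨u, hu, hreach⟩ := exists_closed_after_attack hc ⟨t, ht, hst⟩ hr hra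
    have hdead : Reach weakStep init (u ++ [.an .syn]) ⟨.synsent, .i0, .qa .syn⟩ :=
      hreach.snoc (mem_succs.1 (by decide))
    obtain ⟨v, hv, huv⟩ := hc u hu (.an .syn) (by simp) ⟨_, hdead⟩
    obtain ⟨q', hq', hqa', _⟩ := hK hv
    rw [reach_eq_of_deadlock hdead deadlock_synsent_i0 hq' huv] at hqa'
    exact PSt.noConfusion hqa'
end
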